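/- Let p > 1 and let v ∈ A_p be a weight on ℝⁿ. Then there exists a dimensional constant c_n such that for every f ∈ L¹(v): ‖M(fv)/v‖_{L^{1,∞}(v)} ≤ c_n [v]_{A_∞} max{ p, log(e + [v]_{A_p}) } ‖f‖_{L¹(v)}. -/

import Mathlib

open MeasureTheory ENNReal NNReal

noncomputable section

/-- An axis-parallel cube in `ℝⁿ`. -/
def IsCube {n : ℕ} (Q : Set (Fin n → ℝ)) : Prop :=
  ∃ (a : Fin n → ℝ) (h : ℝ), 0 < h ∧ Q = {x | ∀ i, a i ≤ x i ∧ x i ≤ a i + h}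

/-- Average `(1/|Q|) ∫_Q f` of an `ℝ≥0∞`-valued function over a set. -/
def cubeAvg {n : ℕ} (f : (Fin n → ℝ) → ℝ≥0∞) (Q : Set (Fin n → ℝ)) : ℝ≥0∞ :=
  (∫⁻ x in Q, f x) / MeasureTheory.volume Q

/-- The uncentered Hardy–Littlewood maximal operator over axis-parallel cubes,
for `ℝ≥0∞`-valued functions. -/
def hlM {n : ℕ} (f : (Fin n → ℝ) → ℝ≥0∞) (x : Fin n → ℝ) : ℝ≥0∞ :=
  ⨆ (Q : Set (Fin n → ℝ)) (_ : IsCube Q) (_ : x ∈ Q), cubeAvg f Q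

/-- The Hardy–Littlewood maximal operator applied to a real-valued function:
`Mf(x) = sup_{Q ∋ x} (1/|Q|) ∫_Q |f|`. -/
def hlMR {n : ℕ} (f : (Fin n → ℝ) → ℝ) : (Fin n → ℝ) → ℝ≥0∞ :=
  hlM (fun y => ENNReal.ofReal |f y|)

/-- A weight: a locally integrable, a.e. positive function. -/
def IsWeight {n : ℕ} (w : (Fin n → ℝ) → ℝ) : Prop :=
  MeasureTheory.LocallyIntegrable w MeasureTheory.volume ∧
    ∀ᵐ x ∂(MeasureTheory.volume : MeasureTheory.Measure (Fin n → ℝ)), 0 < w x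

/-- `w(E) = ∫_E w dx`. -/
def wMeas {n : ℕ} (w : (Fin n → ℝ) → ℝ) (E : Set (Fin n → ℝ)) : ℝ≥0∞ :=
  ∫⁻ x in E, ENNReal.ofReal (w x)

/-- The `A₁` constant `[w]_{A₁} = ess sup_x M w(x) / w(x)`. -/
def a1Const {n : ℕ} (w : (Fin n → ℝ) → ℝ) : ℝ≥0∞ :=
  essSup (fun x => hlM (fun y => ENNReal.ofReal (w y)) x / ENNReal.ofReal (w x))
    MeasureTheory.volume

/-- The Fujii–Wilson `A_∞` constant `[w]_{A_∞} = sup_Q (1/∫_Q w) ∫_Q M(w·1_Q)`. -/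
def aInfConst {n : ℕ} (w : (Fin n → ℝ) → ℝ) : ℝ≥0∞ :=
  ⨆ (Q : Set (Fin n → ℝ)) (_ : IsCube Q),
    (∫⁻ x in Q, hlM (Q.indicator fun y => ENNReal.ofReal (w y)) x) / wMeas w Q

/-- The `A_p` constant, `1 < p < ∞`:
`[w]_{A_p} = sup_Q ⟨w⟩_Q (⟨w^{-1/(p-1)}⟩_Q)^{p-1}`. -/
def apConst {n : ℕ} (p : ℝ) (w : (Fin n → ℝ) → ℝ) : ℝ≥0∞ :=
  ⨆ (Q : Set (Fin n → ℝ)) (_ : IsCube Q),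
    cubeAvg (fun y => ENNReal.ofReal (w y)) Q *
      (cubeAvg (fun y => ENNReal.ofReal (w y) ^ (-(1 / (p - 1)))) Q) ^ (p - 1)

/-- The weak norm `‖g‖_{L^{1,∞}(σ)} = sup_{t>0} t · σ({x : g(x) > t})`
for an `ℝ≥0∞`-valued function `g` and a weight `σ`. -/
def wkNorm {n : ℕ} (g : (Fin n → ℝ) → ℝ≥0∞) (σ : (Fin n → ℝ) → ℝ) : ℝ≥0∞ :=
  ⨆ (t : ℝ≥0) (_ : 0 < t), (t : ℝ≥0∞) * wMeas σ {x | (t : ℝ≥0∞) < g x}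

/-- `‖f‖_{L¹(σ)} = ∫ |f| σ dx`. -/
def l1Norm {n : ℕ} (f : (Fin n → ℝ) → ℝ) (σ : (Fin n → ℝ) → ℝ) : ℝ≥0∞ :=
  ∫⁻ x, ENNReal.ofReal |f x| * ENNReal.ofReal (σ x)

/-- `‖g‖_{L^p(σ)} = (∫ g^p σ dx)^{1/p}` for an `ℝ≥0∞`-valued `g`. -/
def lpNormE {n : ℕ} (p : ℝ) (g : (Fin n → ℝ) → ℝ≥0∞) (σ : (Fin n → ℝ) → ℝ) : ℝ≥0∞ :=
  (∫⁻ x, g x ^ p * ENNReal.ofReal (σ x)) ^ (1 / p)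

/-- A bounded, compactly supported measurable function. -/
def BddCompSupp {n : ℕ} (f : (Fin n → ℝ) → ℝ) : Prop :=
  Measurable f ∧ (∃ C : ℝ, ∀ x, |f x| ≤ C) ∧ HasCompactSupport f

end

/-! ### Dyadic cubes -/

/-- The side length of the dyadic cubes of generation `i`, the coarsest ones having side `L`. -/
noncomputable def dySide (L : ℝ) (i : ℕ) : ℝ := L / 2 ^ i

/-- The index of the dyadic cube of generation `i` containing `x`. -/
noncomputable def dyIdx {n : ℕ} (L : ℝ) (i : ℕ) (x : Fin n → ℝ) : Fin n → ℤ := fun j => ⌊x j / dySide L i⌋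

/-- The half-open dyadic cube of generation `q.1` and index `q.2`. -/
def dyCube {n : ℕ} (L : ℝ) (q : ℕ × (Fin n → ℤ)) : Set (Fin n → ℝ) := {x | dyIdx L q.1 x = q.2}

/-- The closed cube concentric with `dyCube L q` and three times as large. -/
def dyTriple {n : ℕ} (L : ℝ) (q : ℕ × (Fin n → ℤ)) : Set (Fin n → ℝ) :=
  {x | ∀ j, ((q.2 j : ℝ) - 1) * dySide L q.1 ≤ x j ∧
    x j ≤ ((q.2 j : ℝ) - 1) * dySide L q.1 + 3 * dySide L q.1}

/-- The members of a family of dyadic cubes which have no strict ancestor in the family. -/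
def dyMax {n : ℕ} (L : ℝ) (P : Set (ℕ × (Fin n → ℤ))) : Set (ℕ × (Fin n → ℤ)) :=
  {q ∈ P | ∀ x ∈ dyCube L q, ∀ i < q.1, (i, dyIdx L i x) ∉ P}

section Dyadic

variable {n : ℕ} {L : ℝ}

theorem dySide_pos (hL : 0 < L) (i : ℕ) : 0 < dySide L i := by
  unfold dySide; positivity

theorem mem_dyCube_iff (hL : 0 < L) {q : ℕ × (Fin n → ℤ)} {x : Fin n → ℝ} :
    x ∈ dyCube L q ↔ ∀ j, (q.2 j : ℝ) * dySide L q.1 ≤ x j ∧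
      x j < ((q.2 j : ℝ) + 1) * dySide L q.1 := by
  have hs := dySide_pos hL q.1
  simp only [dyCube, Set.mem_ofPred_eq, funext_iff, dyIdx, Int.floor_eq_iff, le_div_iff₀ hs,
    div_lt_iff₀ hs]

theorem dyCube_eq_pi (hL : 0 < L) (q : ℕ × (Fin n → ℤ)) :
    dyCube L q = Set.univ.pi fun j =>
      Set.Ico ((q.2 j : ℝ) * dySide L q.1) (((q.2 j : ℝ) + 1) * dySide L q.1) := by
  ext x
  simp [mem_dyCube_iff hL, Set.mem_pi]

theorem measurableSet_dyCube (hL : 0 < L) (q : ℕ × (Fin n → ℤ)) : MeasurableSet (dyCube L q) := by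
  rw [dyCube_eq_pi hL]
  exact MeasurableSet.univ_pi fun _ => measurableSet_Ico

theorem volume_dyCube (hL : 0 < L) (q : ℕ × (Fin n → ℤ)) :
    volume (dyCube L q) = ENNReal.ofReal (dySide L q.1) ^ n := by
  rw [dyCube_eq_pi hL, Real.volume_pi_Ico]
  simp [add_mul]

theorem isCube_dyTriple (hL : 0 < L) (q : ℕ × (Fin n → ℤ)) : IsCube (dyTriple L q) :=
  ⟨fun j => ((q.2 j : ℝ) - 1) * dySide L q.1, 3 * dySide L q.1,
    by have := dySide_pos hL q.1; positivity, rfl⟩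

theorem setOf_cube_eq_Icc (a : Fin n → ℝ) (h : ℝ) :
    {x : Fin n → ℝ | ∀ i, a i ≤ x i ∧ x i ≤ a i + h} = Set.Icc a (fun i => a i + h) := by
  ext x
  simp [Set.mem_Icc, Pi.le_def, forall_and]

theorem volume_setOf_cube (a : Fin n → ℝ) (h : ℝ) :
    volume {x : Fin n → ℝ | ∀ i, a i ≤ x i ∧ x i ≤ a i + h} = ENNReal.ofReal h ^ n := by
  rw [setOf_cube_eq_Icc, Real.volume_Icc_pi]
  simp

theorem IsCube.isCompact {Q : Set (Fin n → ℝ)} (hQ : IsCube Q) : IsCompact Q := by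
  obtain ⟨a, h, -, rfl⟩ := hQ
  rw [setOf_cube_eq_Icc]
  exact isCompact_Icc

theorem IsCube.measurableSet {Q : Set (Fin n → ℝ)} (hQ : IsCube Q) : MeasurableSet Q :=
  hQ.isCompact.measurableSet

theorem IsCube.volume_ne_zero {Q : Set (Fin n → ℝ)} (hQ : IsCube Q) : volume Q ≠ 0 := by
  obtain ⟨a, h, hh, rfl⟩ := hQ
  rw [volume_setOf_cube]
  exact pow_ne_zero _ (ENNReal.ofReal_pos.2 hh).ne'

theorem IsCube.volume_ne_top {Q : Set (Fin n → ℝ)} (hQ : IsCube Q) : volume Q ≠ ∞ :=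
  hQ.isCompact.measure_lt_top.ne

theorem volume_dyTriple (hL : 0 < L) (q : ℕ × (Fin n → ℤ)) :
    volume (dyTriple L q) = 3 ^ n * volume (dyCube L q) := by
  rw [volume_dyCube hL, dyTriple, volume_setOf_cube, ENNReal.ofReal_mul (by norm_num), mul_pow]
  norm_num

theorem dyCube_subset_dyTriple (hL : 0 < L) (q : ℕ × (Fin n → ℤ)) :
    dyCube L q ⊆ dyTriple L q := by
  intro x hx j
  have h := (mem_dyCube_iff hL).1 hx j
  have hs := dySide_pos hL q.1
  constructor <;> nlinarith

theorem dyIdx_add (i d : ℕ) (x : Fin n → ℝ) (j : Fin n) :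
    dyIdx L i x j = dyIdx L (i + d) x j / ((2 ^ d : ℕ) : ℤ) := by
  rw [dyIdx, dyIdx, ← Int.floor_div_natCast]
  congr 1
  simp only [dySide, pow_add]
  by_cases h : L = 0
  · simp [h]
  · push_cast
    field_simp

theorem dyIdx_eq_of_le {i i' : ℕ} (h : i' ≤ i) {x y : Fin n → ℝ}
    (hxy : dyIdx L i x = dyIdx L i y) : dyIdx L i' x = dyIdx L i' y := by
  obtain ⟨d, rfl⟩ := Nat.exists_eq_add_of_le h
  ext j
  rw [dyIdx_add i' d, dyIdx_add i' d, hxy]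

theorem dyTriple_subset_of_mem (hL : 0 < L) {q r : ℕ × (Fin n → ℤ)} (h : r.1 ≤ q.1)
    {x : Fin n → ℝ} (hq : x ∈ dyCube L q) (hr : x ∈ dyCube L r) :
    dyTriple L q ⊆ dyTriple L r := by
  obtain ⟨d, hd⟩ := Nat.exists_eq_add_of_le h
  have hs : dySide L r.1 = 2 ^ d * dySide L q.1 := by
    rw [hd]; simp only [dySide, pow_add]; field_simp
  have hsp := dySide_pos hL q.1
  have h1 : (1 : ℝ) ≤ 2 ^ d := one_le_pow₀ (by norm_num)
  intro y hy j
  have hj : r.2 j = q.2 j / ((2 ^ d : ℕ) : ℤ) := by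
    rw [← hr, ← hq, hd]; exact dyIdx_add r.1 d x j
  have hpos : (0 : ℤ) < ((2 ^ d : ℕ) : ℤ) := by positivity
  have hlo : (r.2 j : ℝ) * 2 ^ d ≤ q.2 j := by
    have : r.2 j * ((2 ^ d : ℕ) : ℤ) ≤ q.2 j := by
      rw [hj]; exact Int.ediv_mul_le _ hpos.ne'
    have := (Int.cast_le (R := ℝ)).2 this
    push_cast at this; exact this
  have hhi : (q.2 j : ℝ) + 1 ≤ (r.2 j + 1) * 2 ^ d := by
    have : q.2 j + 1 ≤ (r.2 j + 1) * ((2 ^ d : ℕ) : ℤ) := by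
      rw [hj]; exact Int.lt_ediv_add_one_mul_self _ hpos
    have := (Int.cast_le (R := ℝ)).2 this
    push_cast at this; exact this
  have hlo' := mul_le_mul_of_nonneg_right hlo hsp.le
  have hhi' := mul_le_mul_of_nonneg_right hhi hsp.le
  have h1' := mul_le_mul_of_nonneg_right h1 hsp.le
  have := hy j
  rw [hs]
  constructor <;> linarith

theorem dyCube_nonempty (hL : 0 < L) (q : ℕ × (Fin n → ℤ)) : (dyCube L q).Nonempty := by
  have hs := dySide_pos hL q.1
  refine ⟨fun j => q.2 j * dySide L q.1, (mem_dyCube_iff hL).2 fun j => ⟨le_rfl, ?_⟩⟩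
  exact mul_lt_mul_of_pos_right (by linarith) hs

theorem eq_of_mem_dyMax {P : Set (ℕ × (Fin n → ℤ))} {q r : ℕ × (Fin n → ℤ)}
    (hq : q ∈ dyMax L P) (hr : r ∈ dyMax L P) {x : Fin n → ℝ}
    (hxq : x ∈ dyCube L q) (hxr : x ∈ dyCube L r) : q = r := by
  have hq' : q = (q.1, dyIdx L q.1 x) := Prod.ext rfl (Eq.symm hxq)
  have hr' : r = (r.1, dyIdx L r.1 x) := Prod.ext rfl (Eq.symm hxr)
  rcases lt_trichotomy q.1 r.1 with h | h | h
  · exact absurd (hq' ▸ hq.1) (hr.2 x hxr _ h)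
  · rw [hq', hr', h]
  · exact absurd (hr' ▸ hr.1) (hq.2 x hxq _ h)

theorem exists_mem_dyMax {P : Set (ℕ × (Fin n → ℤ))} {q : ℕ × (Fin n → ℤ)}
    (hq : q ∈ P) {x : Fin n → ℝ} (hx : x ∈ dyCube L q) :
    ∃ r ∈ dyMax L P, r.1 ≤ q.1 ∧ x ∈ dyCube L r := by
  classical
  have hq' : q = (q.1, dyIdx L q.1 x) := Prod.ext rfl (Eq.symm hx)
  have hex : ∃ i, (i, dyIdx L i x) ∈ P := ⟨q.1, hq' ▸ hq⟩
  refine ⟨(Nat.find hex, dyIdx L (Nat.find hex) x), ⟨Nat.find_spec hex, ?_⟩,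
    Nat.find_min' hex (hq' ▸ hq), rfl⟩
  intro y hy i hi hmem
  refine Nat.find_min hex hi ?_
  rwa [dyIdx_eq_of_le (Nat.le_of_lt hi) hy] at hmem

theorem tsum_measure_dyMax_le (hL : 0 < L) (γ : Measure (Fin n → ℝ))
    (P : Set (ℕ × (Fin n → ℤ))) :
    ∑' r : dyMax L P, γ (dyCube L r) ≤ γ Set.univ := by
  refine (tsum_meas_le_meas_iUnion_of_disjoint γ
    (fun r : dyMax L P => measurableSet_dyCube hL r.1) ?_).trans (measure_mono (Set.subset_univ _))
  intro q r hqr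
  refine Set.disjoint_left.2 fun x hxq hxr => hqr ?_
  exact Subtype.ext (eq_of_mem_dyMax q.2 r.2 hxq hxr)

/-- A cube of side at most `L` with large `γ`-density is contained in the triple of a dyadic cube
with large `γ`-density. -/
theorem exists_dyCube_of_cube (hL : 0 < L) (γ : Measure (Fin n → ℝ)) (c : ℝ≥0∞)
    {a : Fin n → ℝ} {h : ℝ} (hh : 0 < h) (hhL : h ≤ L)
    (hγ : 4 ^ n * c * volume {x : Fin n → ℝ | ∀ i, a i ≤ x i ∧ x i ≤ a i + h} <
      γ {x : Fin n → ℝ | ∀ i, a i ≤ x i ∧ x i ≤ a i + h}) :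
    ∃ q : ℕ × (Fin n → ℤ), c * volume (dyCube L q) < γ (dyCube L q) ∧
      {x : Fin n → ℝ | ∀ i, a i ≤ x i ∧ x i ≤ a i + h} ⊆ dyTriple L q := by
  obtain ⟨i, hi1, hi2⟩ := exists_nat_pow_near_of_lt_one (x := h / L) (y := (1 / 2 : ℝ))
    (by positivity) ((div_le_one hL).2 hhL) (by norm_num) (by norm_num)
  have hs := dySide_pos hL i
  have hs1 : h ≤ dySide L i := by
    rw [div_le_iff₀ hL] at hi2
    simpa [dySide, div_eq_inv_mul] using hi2
  have hs2 : dySide L i ≤ 2 * h := by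
    rw [lt_div_iff₀ hL, pow_succ] at hi1
    have : dySide L i = (1 / 2) ^ i * L := by simp [dySide, div_eq_inv_mul]
    rw [this]; linarith
  set Q := {x : Fin n → ℝ | ∀ i, a i ≤ x i ∧ x i ≤ a i + h} with hQ
  let z : (Fin n → Fin 2) → Fin n → ℤ := fun ε j => ⌊a j / dySide L i⌋ + ((ε j : ℕ) : ℤ)
  have hcover : Q ⊆ ⋃ ε : Fin n → Fin 2, Q ∩ dyCube L (i, z ε) := by
    intro x hx
    have hfl : ∀ j, ∃ e : Fin 2, ⌊x j / dySide L i⌋ = ⌊a j / dySide L i⌋ + ((e : ℕ) : ℤ) := by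
      intro j
      have h1 : ⌊a j / dySide L i⌋ ≤ ⌊x j / dySide L i⌋ := by
        have := (hx j).1
        gcongr
      have h2 : ⌊x j / dySide L i⌋ ≤ ⌊a j / dySide L i⌋ + 1 := by
        rw [← Int.floor_add_one]
        apply Int.floor_le_floor
        rw [div_add_one hs.ne']
        have := (hx j).2
        gcongr
        linarith
      rcases (by omega : ⌊x j / dySide L i⌋ = ⌊a j / dySide L i⌋ + 0 ∨
        ⌊x j / dySide L i⌋ = ⌊a j / dySide L i⌋ + 1) with h | h
      · exact ⟨0, by simpa using h⟩
      · exact ⟨1, by simpa using h⟩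
    choose e he using hfl
    exact Set.mem_iUnion.2 ⟨e, hx, funext he⟩
  have hex : ∃ ε, c * ENNReal.ofReal (dySide L i) ^ n < γ (Q ∩ dyCube L (i, z ε)) := by
    by_contra! hcon
    refine absurd hγ (not_lt.2 ?_)
    calc γ Q ≤ ∑' ε : Fin n → Fin 2, γ (Q ∩ dyCube L (i, z ε)) :=
          (measure_mono hcover).trans (measure_iUnion_le _)
      _ ≤ ∑' ε : Fin n → Fin 2, c * ENNReal.ofReal (2 * h) ^ n := by
          refine ENNReal.tsum_le_tsum fun ε => (hcon ε).trans ?_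
          gcongr
      _ = 4 ^ n * c * volume Q := by
          rw [tsum_fintype, hQ, volume_setOf_cube, ENNReal.ofReal_mul (by norm_num), mul_pow]
          simp only [Finset.sum_const, Finset.card_univ, Fintype.card_pi, Fintype.card_fin,
            Finset.prod_const, nsmul_eq_mul]
          rw [show (4 : ℝ≥0∞) = 2 * 2 by norm_num, mul_pow]
          push_cast
          norm_num
          ring
  obtain ⟨ε, hε⟩ := hex
  refine ⟨(i, z ε), ?_, ?_⟩
  · rw [volume_dyCube hL]
    exact hε.trans_le (measure_mono Set.inter_subset_right)
  · have hne : (Q ∩ dyCube L (i, z ε)).Nonempty := by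
      rw [Set.nonempty_iff_ne_empty]
      intro h0
      simp [h0] at hε
    obtain ⟨y, hyQ, hy⟩ := hne
    intro x hx j
    have h1 := (mem_dyCube_iff hL).1 hy j
    have h2 := hx j
    have h3 := hyQ j
    simp only at h1 ⊢
    constructor <;> linarith

end Dyadic

/-! ### Summation over families of dyadic cubes -/

theorem tsum_subtype_le_tsum_tsum {α ι : Type*} (f : α → ℝ≥0∞) {s : Set α} (G : ι → Set α)
    (h : s ⊆ ⋃ i, G i) : ∑' x : s, f x ≤ ∑' i, ∑' x : G i, f x :=
  (ENNReal.tsum_mono_subtype f h).trans (ENNReal.tsum_iUnion_le_tsum f G)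

theorem tsum_indicator_two_zpow_le (B : ℝ≥0∞) :
    ∑' k : ℤ, {k : ℤ | (2 : ℝ≥0∞) ^ k ≤ B}.indicator (fun k => (2 : ℝ≥0∞) ^ k) k ≤ 2 * B := by
  rcases eq_or_ne B ∞ with rfl | hBt
  · simp
  rcases eq_or_ne B 0 with rfl | hB0
  · refine (ENNReal.tsum_eq_zero.2 fun k => Set.indicator_of_notMem ?_ _).trans_le zero_le
    simpa using (ENNReal.zpow_pos two_ne_zero ENNReal.ofNat_ne_top k).ne'
  obtain ⟨j, hj1, hj2⟩ := ENNReal.exists_mem_Ico_zpow hB0 hBt (y := 2) (by norm_num) (by norm_num)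
  calc ∑' k : ℤ, {k : ℤ | (2 : ℝ≥0∞) ^ k ≤ B}.indicator (fun k => (2 : ℝ≥0∞) ^ k) k
      ≤ ∑' k : ℤ, {k : ℤ | k ≤ j}.indicator (fun k => (2 : ℝ≥0∞) ^ k) k := by
        refine ENNReal.tsum_le_tsum fun k => ?_
        refine Set.indicator_le_indicator_of_subset (fun k hk => ?_) (fun _ => zero_le) k
        by_contra! hcon
        have : (2 : ℝ≥0∞) ^ (j + 1) ≤ 2 ^ k := ENNReal.zpow_le_of_le (by norm_num)
          (by simpa using hcon)
        exact absurd (this.trans hk) (not_le.2 hj2)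
    _ = ∑' k : ℤ, {k : ℤ | k ≤ j}.indicator (fun k => (2 : ℝ≥0∞) ^ k) (k + (j + 1)) :=
        ((Equiv.addRight (j + 1)).tsum_eq _).symm
    _ = ∑' l : ℕ, (2 : ℝ≥0∞) ^ j * (2⁻¹) ^ l := by
        rw [tsum_of_nat_of_neg_add_one ENNReal.summable ENNReal.summable,
          ENNReal.tsum_eq_zero.2, zero_add]
        · refine tsum_congr fun l => ?_
          rw [Set.indicator_of_mem (by simp only [Set.mem_ofPred_eq]; omega), show -((l : ℤ) + 1) + (j + 1) = j + -l by ring,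
            ENNReal.zpow_add two_ne_zero ENNReal.ofNat_ne_top, ENNReal.zpow_neg, zpow_natCast,
            ENNReal.inv_pow]
        · intro l
          refine Set.indicator_of_notMem ?_ _
          simp only [Set.mem_ofPred_eq]
          omega
    _ = 2 * 2 ^ j := by
        rw [ENNReal.tsum_mul_left, ENNReal.tsum_geometric, ENNReal.one_sub_inv_two, inv_inv,
          mul_comm]
    _ ≤ 2 * B := by gcongr

/-- The pairs `(k, q)` such that `q` is a maximal dyadic cube of `γ`-density more than `2 ^ k` and
the `ν`-density of its triple is comparable to `2 ^ (k + m)`. -/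
def densityFamily {n : ℕ} (L : ℝ) (γ ν : Measure (Fin n → ℝ)) (m : ℤ) :
    Set (ℤ × (ℕ × (Fin n → ℤ))) :=
  {q | q.2 ∈ dyMax L {r | 2 ^ q.1 * volume (dyCube L r) < γ (dyCube L r)} ∧
    2 ^ (q.1 + m) * volume (dyTriple L q.2) < ν (dyTriple L q.2) ∧
    ν (dyTriple L q.2) ≤ 2 ^ (q.1 + m + 1) * volume (dyTriple L q.2)}

section Sparse

variable {n : ℕ} {L : ℝ} {γ ν : Measure (Fin n → ℝ)}

theorem tsum_indicator_density_le (hL : 0 < L) {m : ℤ} {G : Set (ℤ × (ℕ × (Fin n → ℤ)))}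
    (hG : G ⊆ densityFamily L γ ν m) {B : ℝ≥0∞} {x : Fin n → ℝ}
    (hB : ∀ q ∈ G, x ∈ dyCube L q.2 → ν (dyTriple L q.2) ≤ B * volume (dyTriple L q.2)) :
    ∑' q : G, (dyCube L q.1.2).indicator
      (fun _ => ν (dyTriple L q.1.2) / volume (dyTriple L q.1.2)) x ≤ 4 * B := by
  let avg : ℤ × (ℕ × (Fin n → ℤ)) → ℝ≥0∞ := fun q =>
    ν (dyTriple L q.2) / volume (dyTriple L q.2)
  let G' : Set (ℤ × (ℕ × (Fin n → ℤ))) := {q ∈ G | x ∈ dyCube L q.2}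
  let φ : ℤ → ℝ≥0∞ := fun k =>
    2 * {k : ℤ | (2 : ℝ≥0∞) ^ k ≤ B}.indicator (fun k => (2 : ℝ≥0∞) ^ k) (k + m)
  have hinj : Function.Injective (fun q : G' => q.1.1) := by
    rintro ⟨⟨k, q⟩, hq, hxq⟩ ⟨⟨k', r⟩, hr, hxr⟩ h
    obtain rfl : k = k' := h
    obtain rfl := eq_of_mem_dyMax (hG hq).1 (hG hr).1 hxq hxr
    rfl
  calc ∑' q : G, (dyCube L q.1.2).indicator (fun _ => avg q.1) x
      = ∑' q : G', avg q.1 := by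
        rw [tsum_subtype G (fun q => (dyCube L q.2).indicator (fun _ => avg q) x),
          tsum_subtype G' avg]
        refine tsum_congr fun q => ?_
        by_cases h1 : q ∈ G <;> by_cases h2 : x ∈ dyCube L q.2 <;>
          simp [Set.indicator, G', h1, h2]
    _ ≤ ∑' q : G', φ q.1.1 := by
        refine ENNReal.tsum_le_tsum fun q => ?_
        obtain ⟨q, hqG, hxq⟩ := q
        obtain ⟨-, h1, h2⟩ := hG hqG
        have hc := isCube_dyTriple hL q.2
        have hmem : (2 : ℝ≥0∞) ^ (q.1 + m) ≤ B := by
          have := h1.trans_le (hB q hqG hxq)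
          exact (ENNReal.mul_lt_mul_iff_left hc.volume_ne_zero hc.volume_ne_top).1 this |>.le
        simp only [φ]
        rw [Set.indicator_of_mem (by exact hmem)]
        refine (ENNReal.div_le_iff hc.volume_ne_zero hc.volume_ne_top).2 (h2.trans_eq ?_)
        rw [ENNReal.zpow_add two_ne_zero ENNReal.ofNat_ne_top, zpow_one, mul_comm (2 ^ _) (2 : ℝ≥0∞)]
    _ ≤ ∑' k : ℤ, φ k := ENNReal.tsum_comp_le_tsum_of_injective hinj φ
    _ = 2 * ∑' k : ℤ, {k : ℤ | (2 : ℝ≥0∞) ^ k ≤ B}.indicator (fun k => (2 : ℝ≥0∞) ^ k) k := by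
        rw [ENNReal.tsum_mul_left]
        congr 1
        exact (Equiv.addRight m).tsum_eq
          ({k : ℤ | (2 : ℝ≥0∞) ^ k ≤ B}.indicator (fun k => (2 : ℝ≥0∞) ^ k))
    _ ≤ 2 * (2 * B) := by gcongr; exact tsum_indicator_two_zpow_le B
    _ = 4 * B := by rw [← mul_assoc]; norm_num

theorem measure_le_hlM_mul {w : (Fin n → ℝ) → ℝ≥0∞} {Q R : Set (Fin n → ℝ)} (hQ : IsCube Q)
    (hQR : Q ⊆ R) {x : Fin n → ℝ} (hx : x ∈ Q) :
    volume.withDensity w Q ≤ hlM (R.indicator w) x * volume Q := by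
  rw [← ENNReal.div_le_iff hQ.volume_ne_zero hQ.volume_ne_top]
  have : volume.withDensity w Q / volume Q = cubeAvg (R.indicator w) Q := by
    rw [cubeAvg, withDensity_apply']
    congr 1
    refine setLIntegral_congr_fun hQ.measurableSet fun y hy => ?_
    rw [Set.indicator_of_mem (hQR hy)]
  rw [this]
  exact le_iSup_of_le Q (le_iSup_of_le hQ (le_iSup_of_le hx le_rfl))

theorem tsum_measure_dyTriple_le_lintegral {w : (Fin n → ℝ) → ℝ≥0∞} (hL : 0 < L) {m : ℤ}
    (r : ℕ × (Fin n → ℤ)) {G : Set (ℤ × (ℕ × (Fin n → ℤ)))}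
    (hG : G ⊆ densityFamily L γ (volume.withDensity w) m)
    (hGr : ∀ q ∈ G, dyTriple L q.2 ⊆ dyTriple L r) :
    ∑' q : G, volume.withDensity w (dyTriple L q.1.2) ≤
      3 ^ n * (4 * ∫⁻ x in dyTriple L r, hlM ((dyTriple L r).indicator w) x) := by
  set ν := volume.withDensity w with hν
  calc ∑' q : G, ν (dyTriple L q.1.2)
      = ∑' q : G, 3 ^ n * ∫⁻ x in dyTriple L r, (dyCube L q.1.2).indicator
          (fun _ => ν (dyTriple L q.1.2) / volume (dyTriple L q.1.2)) x := by
        refine tsum_congr fun q => ?_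
        have hc := isCube_dyTriple hL q.1.2
        rw [lintegral_indicator_const (measurableSet_dyCube hL _),
          Measure.restrict_apply (measurableSet_dyCube hL _),
          Set.inter_eq_left.2 ((dyCube_subset_dyTriple hL _).trans (hGr q.1 q.2)),
          mul_left_comm, ← volume_dyTriple hL, ENNReal.div_mul_cancel hc.volume_ne_zero
          hc.volume_ne_top]
    _ = 3 ^ n * ∫⁻ x in dyTriple L r, ∑' q : G, (dyCube L q.1.2).indicator
          (fun _ => ν (dyTriple L q.1.2) / volume (dyTriple L q.1.2)) x := by
        rw [ENNReal.tsum_mul_left, lintegral_tsum]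
        exact fun q => (measurable_const.indicator (measurableSet_dyCube hL _)).aemeasurable
    _ ≤ 3 ^ n * ∫⁻ x in dyTriple L r, 4 * hlM ((dyTriple L r).indicator w) x := by
        gcongr with x
        exact tsum_indicator_density_le hL hG fun q hq hxq =>
          measure_le_hlM_mul (isCube_dyTriple hL _) (hGr q hq) (dyCube_subset_dyTriple hL _ hxq)
    _ = _ := by rw [lintegral_const_mul' _ _ (by norm_num)]

theorem tsum_measure_densityFamily_le {w : (Fin n → ℝ) → ℝ≥0∞} (hL : 0 < L) {A : ℝ≥0∞}
    (hA : ∀ R : Set (Fin n → ℝ), IsCube R →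
      ∫⁻ x in R, hlM (R.indicator w) x ≤ A * volume.withDensity w R) (m : ℤ) :
    ∑' q : densityFamily L γ (volume.withDensity w) m,
      volume.withDensity w (dyTriple L q.1.2) ≤ 8 * 9 ^ n * A * 2 ^ m * γ Set.univ := by
  set ν := volume.withDensity w with hν
  set F := densityFamily L γ ν m with hF
  let T : Set (ℕ × (Fin n → ℤ)) := {q | ∃ k, (k, q) ∈ F}
  let G : dyMax L T → Set (ℤ × (ℕ × (Fin n → ℤ))) := fun r =>
    {q ∈ F | dyTriple L q.2 ⊆ dyTriple L r.1}
  have hcover : F ⊆ ⋃ r, G r := by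
    intro q hq
    obtain ⟨x, hx⟩ := dyCube_nonempty hL q.2
    obtain ⟨r, hr, hrq, hxr⟩ := exists_mem_dyMax (P := T) ⟨q.1, hq⟩ hx
    exact Set.mem_iUnion.2 ⟨⟨r, hr⟩, hq, dyTriple_subset_of_mem hL hrq hx hxr⟩
  have h₁ := tsum_subtype_le_tsum_tsum (fun q => ν (dyTriple L q.2)) G hcover
  have h₂ : ∑' r, ∑' q : G r, ν (dyTriple L q.1.2) ≤
      ∑' r : dyMax L T, 8 * 9 ^ n * A * 2 ^ m * γ (dyCube L r) := by
    refine ENNReal.tsum_le_tsum fun r => ?_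
    refine (tsum_measure_dyTriple_le_lintegral hL r.1 (fun q hq => hq.1)
      (fun q hq => hq.2)).trans ?_
    obtain ⟨r, ⟨k, hr1, -, hr2⟩, -⟩ := r
    have hγ : 2 ^ k * volume (dyCube L r) < γ (dyCube L r) := hr1.1
    simp only at hr2 ⊢
    calc 3 ^ n * (4 * ∫⁻ x in dyTriple L r, hlM ((dyTriple L r).indicator w) x)
        ≤ 3 ^ n * (4 * (A * (2 ^ (k + m + 1) * volume (dyTriple L r)))) := by
          gcongr
          refine (hA _ (isCube_dyTriple hL r)).trans ?_
          gcongr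
      _ = 8 * 9 ^ n * A * 2 ^ m * (2 ^ k * volume (dyCube L r)) := by
          rw [volume_dyTriple hL, ENNReal.zpow_add two_ne_zero ENNReal.ofNat_ne_top,
            ENNReal.zpow_add two_ne_zero ENNReal.ofNat_ne_top, zpow_one,
            show (9 : ℝ≥0∞) = 3 * 3 by norm_num, mul_pow]
          ring
      _ ≤ _ := by gcongr
  refine h₁.trans (h₂.trans ?_)
  rw [ENNReal.tsum_mul_left]
  gcongr
  exact tsum_measure_dyMax_le hL γ T

/-- The weak-type estimate for the maximal operator restricted to cubes of side at most `L`. -/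
theorem withDensity_setOf_cube_le {w : (Fin n → ℝ) → ℝ≥0∞} (hw : Measurable w)
    (hw0 : ∀ᵐ x, w x ≠ 0) (hwt : ∀ x, w x ≠ ∞) (hL : 0 < L) {A : ℝ≥0∞}
    (hν : ∀ R : Set (Fin n → ℝ), IsCube R →
      volume.withDensity w R ≠ 0 ∧ volume.withDensity w R ≠ ∞)
    (hA : ∀ R : Set (Fin n → ℝ), IsCube R →
      ∫⁻ x in R, hlM (R.indicator w) x ≤ A * volume.withDensity w R)
    {θ : ℤ → ℝ≥0∞}
    (hθ : ∀ (k m : ℤ) (R : Set (Fin n → ℝ)), IsCube R →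
      2 ^ (k + m) * volume R < volume.withDensity w R →
      volume.withDensity w R ≤ 2 ^ (k + m + 1) * volume R →
      volume (R ∩ {x | 4 ^ n * 2 ^ k < w x ∧ w x ≤ 4 ^ n * 2 ^ (k + 1)}) ≤ θ m * volume R) :
    volume.withDensity w {x | ∃ (a : Fin n → ℝ) (h : ℝ), 0 < h ∧ h ≤ L ∧
        x ∈ {x : Fin n → ℝ | ∀ i, a i ≤ x i ∧ x i ≤ a i + h} ∧
        w x * volume {x : Fin n → ℝ | ∀ i, a i ≤ x i ∧ x i ≤ a i + h} <
          γ {x : Fin n → ℝ | ∀ i, a i ≤ x i ∧ x i ≤ a i + h}} ≤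
      16 * 36 ^ n * A * (∑' m, θ m) * γ Set.univ := by
  set ν := volume.withDensity w with hνdef
  let V : ℤ → Set (Fin n → ℝ) := fun k => {x | 4 ^ n * 2 ^ k < w x ∧ w x ≤ 4 ^ n * 2 ^ (k + 1)}
  let S : Set (ℤ × (ℕ × (Fin n → ℤ))) :=
    {q | q.2 ∈ dyMax L {r | 2 ^ q.1 * volume (dyCube L r) < γ (dyCube L r)}}
  have h4 : (4 : ℝ≥0∞) ^ n ≠ 0 := pow_ne_zero _ (by norm_num)
  have h4t : (4 : ℝ≥0∞) ^ n ≠ ∞ := ENNReal.pow_ne_top (by norm_num)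
  have hcover : {x | ∃ (a : Fin n → ℝ) (h : ℝ), 0 < h ∧ h ≤ L ∧
        x ∈ {x : Fin n → ℝ | ∀ i, a i ≤ x i ∧ x i ≤ a i + h} ∧
        w x * volume {x : Fin n → ℝ | ∀ i, a i ≤ x i ∧ x i ≤ a i + h} <
          γ {x : Fin n → ℝ | ∀ i, a i ≤ x i ∧ x i ≤ a i + h}} ⊆
      {x | ¬ w x ≠ 0} ∪ ⋃ q ∈ S, dyTriple L q.2 ∩ V q.1 := by
    rintro x ⟨a, h, hh, hhL, hxQ, hxγ⟩
    by_cases hx0 : w x = 0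
    · exact Or.inl (by simpa using hx0)
    right
    obtain ⟨k, hk1, hk2⟩ := ENNReal.exists_mem_Ioc_zpow (x := w x / 4 ^ n) (y := 2)
      (ENNReal.div_ne_zero.2 ⟨hx0, h4t⟩) (ENNReal.div_ne_top (hwt x) h4) (by norm_num)
      (by norm_num)
    rw [ENNReal.lt_div_iff_mul_lt (Or.inl h4) (Or.inl h4t), mul_comm] at hk1
    rw [ENNReal.div_le_iff h4 h4t, mul_comm] at hk2
    obtain ⟨q, hq, hQq⟩ := exists_dyCube_of_cube hL γ (2 ^ k) hh hhL
      (lt_of_le_of_lt (by gcongr) hxγ)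
    obtain ⟨y, hy⟩ := dyCube_nonempty hL q
    obtain ⟨r, hr, hrq, hyr⟩ := exists_mem_dyMax
      (P := {r | 2 ^ k * volume (dyCube L r) < γ (dyCube L r)}) hq hy
    exact Set.mem_biUnion (show (k, r) ∈ S from hr)
      ⟨dyTriple_subset_of_mem hL hrq hy hyr (hQq hxQ), hk1, hk2⟩
  have hSF : S ⊆ ⋃ m, densityFamily L γ ν m := by
    intro q hq
    have hc := isCube_dyTriple hL q.2
    obtain ⟨l, hl1, hl2⟩ := ENNReal.exists_mem_Ioc_zpow
      (x := ν (dyTriple L q.2) / volume (dyTriple L q.2)) (y := 2)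
      (ENNReal.div_ne_zero.2 ⟨(hν _ hc).1, hc.volume_ne_top⟩)
      (ENNReal.div_ne_top (hν _ hc).2 hc.volume_ne_zero) (by norm_num) (by norm_num)
    rw [ENNReal.lt_div_iff_mul_lt (Or.inl hc.volume_ne_zero) (Or.inl hc.volume_ne_top)] at hl1
    rw [ENNReal.div_le_iff hc.volume_ne_zero hc.volume_ne_top] at hl2
    refine Set.mem_iUnion.2 ⟨l - q.1, hq, ?_, ?_⟩
    · rwa [add_sub_cancel]
    · rwa [add_sub_cancel]
  have hV : ∀ k, MeasurableSet (V k) := fun k =>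
    (measurableSet_lt measurable_const hw).inter (measurableSet_le hw measurable_const)
  have hnull : ν {x | ¬ w x ≠ 0} = 0 :=
    withDensity_absolutelyContinuous volume w (ae_iff.1 hw0)
  have hterm : ∀ m, ∀ q ∈ densityFamily L γ ν m, ν (dyTriple L q.2 ∩ V q.1) ≤
      2 * 4 ^ n * 2 ^ (-m) * θ m * ν (dyTriple L q.2) := by
    rintro m q ⟨-, hq1, hq2⟩
    have hc := isCube_dyTriple hL q.2
    calc ν (dyTriple L q.2 ∩ V q.1)
        ≤ 4 ^ n * 2 ^ (q.1 + 1) * volume (dyTriple L q.2 ∩ V q.1) := by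
          rw [hνdef, withDensity_apply', ← setLIntegral_const]
          exact setLIntegral_mono' (hc.measurableSet.inter (hV _)) fun x hx => hx.2.2
      _ ≤ 4 ^ n * 2 ^ (q.1 + 1) * (θ m * volume (dyTriple L q.2)) := by
          gcongr
          exact hθ q.1 m _ hc hq1 hq2
      _ = 2 * 4 ^ n * 2 ^ (-m) * θ m * (2 ^ (q.1 + m) * volume (dyTriple L q.2)) := by
          rw [show q.1 + 1 = -m + (q.1 + m) + 1 by ring]
          simp only [ENNReal.zpow_add two_ne_zero ENNReal.ofNat_ne_top, zpow_one]
          ring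
      _ ≤ _ := by gcongr
  have h₀ := measure_biUnion_le ν S.to_countable (fun q => dyTriple L q.2 ∩ V q.1)
  have h₁ := tsum_subtype_le_tsum_tsum (fun q => ν (dyTriple L q.2 ∩ V q.1)) _ hSF
  have h₂ : ∑' m, ∑' q : densityFamily L γ ν m, ν (dyTriple L q.1.2 ∩ V q.1.1) ≤
      ∑' m, 16 * 36 ^ n * A * γ Set.univ * θ m := by
    refine ENNReal.tsum_le_tsum fun m => ?_
    calc ∑' q : densityFamily L γ ν m, ν (dyTriple L q.1.2 ∩ V q.1.1)
        ≤ ∑' q : densityFamily L γ ν m,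
            2 * 4 ^ n * 2 ^ (-m) * θ m * ν (dyTriple L q.1.2) :=
          ENNReal.tsum_le_tsum fun q => hterm m q.1 q.2
      _ = 2 * 4 ^ n * 2 ^ (-m) * θ m *
            ∑' q : densityFamily L γ ν m, ν (dyTriple L q.1.2) := ENNReal.tsum_mul_left
      _ ≤ 2 * 4 ^ n * 2 ^ (-m) * θ m * (8 * 9 ^ n * A * 2 ^ m * γ Set.univ) := by
          gcongr
          exact tsum_measure_densityFamily_le hL hA m
      _ = 16 * 36 ^ n * A * γ Set.univ * θ m * (2 ^ (-m) * 2 ^ m) := by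
          rw [show (36 : ℝ≥0∞) = 4 * 9 by norm_num, mul_pow]
          ring
      _ = _ := by
          rw [← ENNReal.zpow_add two_ne_zero ENNReal.ofNat_ne_top]
          simp
  refine (measure_mono hcover).trans ((measure_union_le _ _).trans ?_)
  rw [hnull, zero_add]
  refine h₀.trans (h₁.trans (h₂.trans_eq ?_))
  rw [ENNReal.tsum_mul_left]
  ring

end Sparse

/-! ### Level sets of a weight on a cube -/

/-- A bound for the fraction of a cube on which a weight `w` is comparable to `2 ^ k`, when the mean
of `w` is comparable to `2 ^ (k + m)`. -/
noncomputable def levelFraction (s : ℝ) (l : ℕ) : ℤ → ℝ≥0∞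
  | Int.ofNat m => if m < l then 1 else ((2⁻¹ : ℝ≥0∞) ^ s) ^ (m - l)
  | Int.negSucc m => 2⁻¹ ^ m

theorem tsum_levelFraction (s : ℝ) (l : ℕ) :
    ∑' m, levelFraction s l m = l + (1 - (2⁻¹ : ℝ≥0∞) ^ s)⁻¹ + 2 := by
  rw [tsum_of_nat_of_neg_add_one ENNReal.summable ENNReal.summable]
  congr 1
  · rw [← Summable.sum_add_tsum_nat_add' (k := l) ENNReal.summable]
    congr 1
    · rw [Finset.sum_congr rfl (g := fun _ => (1 : ℝ≥0∞))]
      · simp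
      · intro m hm
        exact if_pos (Finset.mem_range.1 hm)
    · rw [← ENNReal.tsum_geometric]
      refine tsum_congr fun m => ?_
      have : levelFraction s l ((m + l : ℕ) : ℤ) =
        if m + l < l then 1 else ((2⁻¹ : ℝ≥0∞) ^ s) ^ (m + l - l) := rfl
      rw [this, if_neg (by omega), Nat.add_sub_cancel]
  · have : ∀ m : ℕ, levelFraction s l (-((m : ℤ) + 1)) = 2⁻¹ ^ m := fun m => by
      rw [show -((m : ℤ) + 1) = Int.negSucc m by rw [Int.negSucc_eq]]
      rfl
    simp only [this]
    rw [ENNReal.tsum_geometric, ENNReal.one_sub_inv_two, inv_inv]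

theorem inv_one_sub_half_rpow_le {p : ℝ} (hp : 1 < p) :
    (1 - (2⁻¹ : ℝ≥0∞) ^ (1 / (p - 1)))⁻¹ ≤ ENNReal.ofReal (2 * p) := by
  have hp1 : 0 < p - 1 := sub_pos.2 hp
  have hs : 0 < 1 / (p - 1) := by positivity
  have h2 : 1 + (1 / (p - 1)) / 2 ≤ (2 : ℝ) ^ (1 / (p - 1)) := by
    rw [Real.rpow_def_of_pos two_pos]
    have h := Real.add_one_le_exp (Real.log 2 * (1 / (p - 1)))
    have := Real.log_two_gt_d9
    nlinarith
  have h3 : ((2 : ℝ)⁻¹) ^ (1 / (p - 1)) ≤ 1 - (2 * p)⁻¹ := by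
    rw [Real.inv_rpow two_pos.le]
    refine (inv_anti₀ (by positivity) h2).trans ?_
    rw [inv_le_iff_one_le_mul₀ (by positivity)]
    field_simp
    nlinarith
  have hr : (2⁻¹ : ℝ≥0∞) ^ (1 / (p - 1)) = ENNReal.ofReal ((2 : ℝ)⁻¹ ^ (1 / (p - 1))) := by
    rw [← ENNReal.ofReal_rpow_of_pos (by norm_num), ENNReal.ofReal_inv_of_pos two_pos]
    norm_num
  rw [hr, ← ENNReal.ofReal_one, ← ENNReal.ofReal_sub _ (by positivity), ENNReal.inv_le_iff_inv_le,
    ← ENNReal.ofReal_inv_of_pos (by positivity)]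
  exact ENNReal.ofReal_le_ofReal (by linarith)

theorem tsum_levelFraction_le (n : ℕ) {p : ℝ} (hp : 1 < p) {K : ℝ} (hK : 0 ≤ K) :
    ∑' m, levelFraction (1 / (p - 1)) (2 * n + 1 + ⌈Real.logb 2 (Real.exp 1 + K)⌉₊) m ≤
      ((2 * n + 8 : ℕ) : ℝ≥0∞) * ENNReal.ofReal (max p (Real.log (Real.exp 1 + K))) := by
  set X := max p (Real.log (Real.exp 1 + K)) with hX
  have hX1 : 1 ≤ X := hp.le.trans (le_max_left _ _)
  have hlog : 1 ≤ Real.log (Real.exp 1 + K) := by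
    rw [Real.le_log_iff_exp_le (by positivity)]
    linarith
  have hlogb : Real.logb 2 (Real.exp 1 + K) ≤ 2 * X := by
    rw [Real.logb, div_le_iff₀ (Real.log_pos one_lt_two)]
    have := Real.log_two_gt_d9
    have := le_max_right p (Real.log (Real.exp 1 + K))
    nlinarith
  have hlogb0 : 0 ≤ Real.logb 2 (Real.exp 1 + K) :=
    div_nonneg (by linarith) (Real.log_pos one_lt_two).le
  have hceil := (Nat.ceil_lt_add_one hlogb0).le
  calc _ ≤ ((2 * n + 1 + ⌈Real.logb 2 (Real.exp 1 + K)⌉₊ : ℕ) : ℝ≥0∞) +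
        ENNReal.ofReal (2 * p) + 2 := by
        rw [tsum_levelFraction]
        gcongr
        exact inv_one_sub_half_rpow_le hp
    _ = ENNReal.ofReal (((2 * n + 1 + ⌈Real.logb 2 (Real.exp 1 + K)⌉₊ : ℕ) : ℝ) + 2 * p + 2) := by
        rw [ENNReal.ofReal_add (by positivity) (by norm_num),
          ENNReal.ofReal_add (by positivity) (by positivity), ENNReal.ofReal_natCast]
        norm_num
    _ ≤ ENNReal.ofReal (((2 * n + 8 : ℕ) : ℝ) * X) := by
        apply ENNReal.ofReal_le_ofReal
        have hpX : p ≤ X := le_max_left _ _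
        have hnX : (n : ℝ) ≤ n * X := le_mul_of_one_le_right (by positivity) hX1
        push_cast
        linarith
    _ = _ := by
        rw [ENNReal.ofReal_mul (by positivity), ENNReal.ofReal_natCast]

theorem volume_inter_setOf_le_of_ap {n : ℕ} {w : (Fin n → ℝ) → ℝ≥0∞} {p : ℝ} (hp : 1 < p)
    {K c t : ℝ≥0∞} {R : Set (Fin n → ℝ)} (hR : IsCube R)
    (hw : Measurable w) (hc0 : c ≠ 0) (hct : c ≠ ∞) (ht0 : t ≠ 0) (htt : t ≠ ∞)
    (hAp : cubeAvg w R * cubeAvg (fun y => w y ^ (-(1 / (p - 1)))) R ^ (p - 1) ≤ K)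
    (hc : c ≤ cubeAvg w R) :
    volume (R ∩ {x | w x ≤ t}) ≤ (t * (K / c)) ^ (1 / (p - 1)) * volume R := by
  have hp1 : 0 < p - 1 := sub_pos.2 hp
  set s := 1 / (p - 1) with hs
  have hs0 : 0 < s := by positivity
  set σ := cubeAvg (fun y => w y ^ (-s)) R with hσ
  have hσK : σ ≤ (K / c) ^ s := by
    have h1 : σ ^ (p - 1) ≤ K / c := by
      rw [ENNReal.le_div_iff_mul_le (Or.inl hc0) (Or.inl hct), mul_comm]
      exact le_trans (by gcongr) hAp
    calc σ = (σ ^ (p - 1)) ^ s := by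
          rw [← ENNReal.rpow_mul, hs, mul_one_div_cancel hp1.ne', ENNReal.rpow_one]
      _ ≤ _ := ENNReal.rpow_le_rpow h1 hs0.le
  have hE : MeasurableSet (R ∩ {x | w x ≤ t}) :=
    hR.measurableSet.inter (measurableSet_le hw measurable_const)
  have h2 : t ^ (-s) * volume (R ∩ {x | w x ≤ t}) ≤ σ * volume R := by
    rw [hσ, cubeAvg, ENNReal.div_mul_cancel hR.volume_ne_zero hR.volume_ne_top,
      ← setLIntegral_const]
    calc ∫⁻ x in R ∩ {x | w x ≤ t}, t ^ (-s)
        ≤ ∫⁻ x in R ∩ {x | w x ≤ t}, w x ^ (-s) := by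
          refine setLIntegral_mono' hE fun x hx => ?_
          rw [ENNReal.rpow_neg, ENNReal.rpow_neg, ENNReal.inv_le_inv]
          exact ENNReal.rpow_le_rpow hx.2 hs0.le
      _ ≤ ∫⁻ x in R, w x ^ (-s) := lintegral_mono_set Set.inter_subset_left
  calc volume (R ∩ {x | w x ≤ t})
      = t ^ s * (t ^ (-s) * volume (R ∩ {x | w x ≤ t})) := by
        rw [← mul_assoc, ← ENNReal.rpow_add _ _ ht0 htt, add_neg_cancel, ENNReal.rpow_zero,
          one_mul]
    _ ≤ t ^ s * ((K / c) ^ s * volume R) := by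
        exact mul_le_mul_right (h2.trans (by gcongr)) _
    _ = _ := by rw [ENNReal.mul_rpow_of_nonneg _ _ hs0.le, mul_assoc]

theorem volume_inter_level_le {n : ℕ} {w : (Fin n → ℝ) → ℝ≥0∞} {p : ℝ} (hp : 1 < p)
    {K : ℝ≥0∞} {R : Set (Fin n → ℝ)} (hR : IsCube R) (hw : Measurable w)
    (hAp : cubeAvg w R * cubeAvg (fun y => w y ^ (-(1 / (p - 1)))) R ^ (p - 1) ≤ K)
    {l : ℕ} (hl : 2 * 4 ^ n * K ≤ 2 ^ l) {k m : ℤ}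
    (h₁ : 2 ^ (k + m) * volume R < volume.withDensity w R)
    (h₂ : volume.withDensity w R ≤ 2 ^ (k + m + 1) * volume R) :
    volume (R ∩ {x | 4 ^ n * 2 ^ k < w x ∧ w x ≤ 4 ^ n * 2 ^ (k + 1)}) ≤
      levelFraction (1 / (p - 1)) l m * volume R := by
  have hadd := @ENNReal.zpow_add 2 two_ne_zero ENNReal.ofNat_ne_top
  have hpos : ∀ j : ℤ, (2 : ℝ≥0∞) ^ j ≠ 0 := fun j =>
    (ENNReal.zpow_pos two_ne_zero ENNReal.ofNat_ne_top j).ne'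
  have htop : ∀ j : ℤ, (2 : ℝ≥0∞) ^ j ≠ ∞ := fun j =>
    (ENNReal.zpow_lt_top two_ne_zero ENNReal.ofNat_ne_top j).ne
  have h4 : (4 : ℝ≥0∞) ^ n ≠ 0 := pow_ne_zero _ (by norm_num)
  have h4t : (4 : ℝ≥0∞) ^ n ≠ ∞ := ENNReal.pow_ne_top (by norm_num)
  have hs0 : 0 < 1 / (p - 1) := by have := sub_pos.2 hp; positivity
  rcases m with m | m
  · change _ ≤ (if m < l then 1 else ((2⁻¹ : ℝ≥0∞) ^ (1 / (p - 1))) ^ (m - l)) * volume R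
    split_ifs with hml
    · rw [one_mul]
      exact measure_mono Set.inter_subset_left
    · obtain ⟨d, rfl⟩ := Nat.exists_eq_add_of_le (not_lt.1 hml)
      have hc : (2 : ℝ≥0∞) ^ (k + ((l + d : ℕ) : ℤ)) ≤ cubeAvg w R := by
        rw [cubeAvg, ← withDensity_apply',
          ENNReal.le_div_iff_mul_le (Or.inl hR.volume_ne_zero) (Or.inl hR.volume_ne_top)]
        exact h₁.le
      refine (measure_mono (Set.inter_subset_inter_right R fun x hx => hx.2)).trans
        ((volume_inter_setOf_le_of_ap hp hR hw (hpos _) (htop _) (mul_ne_zero h4 (hpos _))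
          (ENNReal.mul_ne_top h4t (htop _)) hAp hc).trans ?_)
      gcongr
      have hpow : ((2⁻¹ : ℝ≥0∞) ^ (1 / (p - 1))) ^ d = (2⁻¹ ^ d) ^ (1 / (p - 1)) := by
        rw [← ENNReal.rpow_natCast, ← ENNReal.rpow_mul, mul_comm, ENNReal.rpow_mul,
          ENNReal.rpow_natCast]
      rw [Nat.add_sub_cancel_left, hpow]
      refine ENNReal.rpow_le_rpow ?_ hs0.le
      rw [← mul_div_assoc, ENNReal.div_le_iff (hpos _) (htop _)]
      calc 4 ^ n * 2 ^ (k + 1) * K = 2 ^ k * (2 * 4 ^ n * K) := by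
            rw [hadd, zpow_one]; ring
        _ ≤ 2 ^ k * 2 ^ l := by gcongr
        _ = 2⁻¹ ^ d * 2 ^ (k + ((l + d : ℕ) : ℤ)) := by
            have hd : (2⁻¹ : ℝ≥0∞) ^ d * 2 ^ d = 1 := by
              rw [← mul_pow, ENNReal.inv_mul_cancel two_ne_zero ENNReal.ofNat_ne_top, one_pow]
            rw [hadd, zpow_natCast, pow_add, mul_left_comm, mul_left_comm (2⁻¹ ^ d), hd, mul_one]
  · change _ ≤ 2⁻¹ ^ m * volume R
    have hE : MeasurableSet (R ∩ {x | 4 ^ n * 2 ^ k < w x ∧ w x ≤ 4 ^ n * 2 ^ (k + 1)}) :=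
      hR.measurableSet.inter
        ((measurableSet_lt measurable_const hw).inter (measurableSet_le hw measurable_const))
    set E := R ∩ {x | 4 ^ n * 2 ^ k < w x ∧ w x ≤ 4 ^ n * 2 ^ (k + 1)} with hEdef
    have key : 2 ^ k * volume E ≤ 2 ^ k * (2⁻¹ ^ m * volume R) := by
      calc 2 ^ k * volume E ≤ volume.withDensity w E := by
            rw [withDensity_apply', ← setLIntegral_const]
            refine setLIntegral_mono' hE fun x hx => le_trans ?_ hx.2.1.le
            exact le_mul_of_one_le_left zero_le (one_le_pow₀ (by norm_num))
        _ ≤ volume.withDensity w R := measure_mono Set.inter_subset_left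
        _ ≤ 2 ^ (k + Int.negSucc m + 1) * volume R := h₂
        _ = 2 ^ k * (2⁻¹ ^ m * volume R) := by
            rw [show k + Int.negSucc m + 1 = k + -(m : ℤ) by rw [Int.negSucc_eq]; ring, hadd,
              ENNReal.zpow_neg, zpow_natCast, ENNReal.inv_pow, mul_assoc]
    exact (ENNReal.mul_le_mul_iff_right (hpos k) (htop k)).1 key

/-! ### The maximal operator -/

theorem cubeAvg_congr_ae {n : ℕ} {f g : (Fin n → ℝ) → ℝ≥0∞} (h : f =ᵐ[volume] g)
    (Q : Set (Fin n → ℝ)) : cubeAvg f Q = cubeAvg g Q := by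
  rw [cubeAvg, cubeAvg, lintegral_congr_ae (ae_restrict_of_ae h)]

theorem hlM_congr_ae {n : ℕ} {f g : (Fin n → ℝ) → ℝ≥0∞} (h : f =ᵐ[volume] g) : hlM f = hlM g := by
  ext x
  simp only [hlM, cubeAvg_congr_ae h]

theorem wMeas_eq_withDensity {n : ℕ} {v : (Fin n → ℝ) → ℝ} {w : (Fin n → ℝ) → ℝ≥0∞}
    (h : (fun x => ENNReal.ofReal (v x)) =ᵐ[volume] w) (E : Set (Fin n → ℝ)) :
    wMeas v E = volume.withDensity w E := by
  rw [withDensity_apply', wMeas, lintegral_congr_ae (ae_restrict_of_ae h)]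

theorem wMeas_ne_zero {n : ℕ} {v : (Fin n → ℝ) → ℝ} (hv : IsWeight v) {Q : Set (Fin n → ℝ)}
    (hQ : IsCube Q) : wMeas v Q ≠ 0 := by
  intro h0
  have hm : AEMeasurable (fun x => ENNReal.ofReal (v x)) (volume.restrict Q) :=
    hv.1.aestronglyMeasurable.aemeasurable.ennreal_ofReal.restrict
  rw [wMeas, lintegral_eq_zero_iff' hm] at h0
  have hfalse : ∀ᵐ x ∂volume.restrict Q, False := by
    filter_upwards [h0, ae_restrict_of_ae hv.2] with x hx hpos
    exact (ENNReal.ofReal_pos.2 hpos).ne' hx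
  have hzero : volume.restrict Q = 0 := by simpa [ae_iff] using hfalse
  exact hQ.volume_ne_zero (Measure.restrict_eq_zero.1 hzero)

theorem wMeas_ne_top {n : ℕ} {v : (Fin n → ℝ) → ℝ} (hv : IsWeight v) {Q : Set (Fin n → ℝ)}
    (hQ : IsCube Q) : wMeas v Q ≠ ∞ := by
  refine ne_top_of_le_ne_top (hv.1.integrableOn_isCompact hQ.isCompact).2.ne ?_
  exact lintegral_mono fun x => Real.ofReal_le_enorm _

theorem lintegral_hlM_le_aInfConst_mul {n : ℕ} {v : (Fin n → ℝ) → ℝ} (hv : IsWeight v)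
    {Q : Set (Fin n → ℝ)} (hQ : IsCube Q) :
    ∫⁻ x in Q, hlM (Q.indicator fun y => ENNReal.ofReal (v y)) x ≤ aInfConst v * wMeas v Q := by
  rw [← ENNReal.div_le_iff (wMeas_ne_zero hv hQ) (wMeas_ne_top hv hQ)]
  exact le_iSup₂_of_le Q hQ le_rfl

theorem withDensity_setOf_exists_cube_le {n : ℕ} {p : ℝ} (hp : 1 < p) {v : (Fin n → ℝ) → ℝ}
    (hv : IsWeight v) (hvp : apConst p v ≠ ∞) {w : (Fin n → ℝ) → ℝ≥0∞} (hw : Measurable w)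
    (hwt : ∀ x, w x ≠ ∞) (hvw : (fun x => ENNReal.ofReal (v x)) =ᵐ[volume] w)
    (γ : Measure (Fin n → ℝ)) :
    volume.withDensity w {x | ∃ Q, IsCube Q ∧ x ∈ Q ∧ w x * volume Q < γ Q} ≤
      16 * 36 ^ n * aInfConst v * (((2 * n + 8 : ℕ) : ℝ≥0∞) *
        ENNReal.ofReal (max p (Real.log (Real.exp 1 + (apConst p v).toReal)))) * γ Set.univ := by
  set K := (apConst p v).toReal with hKdef
  have hK0 : 0 ≤ K := ENNReal.toReal_nonneg
  let E : ℕ → Set (Fin n → ℝ) := fun N => {x | ∃ (a : Fin n → ℝ) (h : ℝ), 0 < h ∧ h ≤ N + 1 ∧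
    x ∈ {x : Fin n → ℝ | ∀ i, a i ≤ x i ∧ x i ≤ a i + h} ∧
    w x * volume {x : Fin n → ℝ | ∀ i, a i ≤ x i ∧ x i ≤ a i + h} <
      γ {x : Fin n → ℝ | ∀ i, a i ≤ x i ∧ x i ≤ a i + h}}
  have hE : Monotone E := by
    rintro N N' hN x ⟨a, h, hh, hhN, hx⟩
    have : (N : ℝ) ≤ N' := by exact_mod_cast hN
    exact ⟨a, h, hh, by linarith, hx⟩
  have hcover : {x | ∃ Q, IsCube Q ∧ x ∈ Q ∧ w x * volume Q < γ Q} ⊆ ⋃ N, E N := by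
    rintro x ⟨Q, ⟨a, h, hh, rfl⟩, hx, hγ⟩
    obtain ⟨N, hN⟩ := exists_nat_ge h
    exact Set.mem_iUnion.2 ⟨N, a, h, hh, by linarith, hx, hγ⟩
  refine (measure_mono hcover).trans ?_
  rw [hE.measure_iUnion]
  refine iSup_le fun N => ?_
  have hw0 : ∀ᵐ x, w x ≠ 0 := by
    filter_upwards [hvw, hv.2] with x hx hpos
    rw [← hx]
    exact (ENNReal.ofReal_pos.2 hpos).ne'
  have hl : 2 * 4 ^ n * ENNReal.ofReal (Real.exp 1 + K) ≤
      2 ^ (2 * n + 1 + ⌈Real.logb 2 (Real.exp 1 + K)⌉₊) := by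
    have h : Real.exp 1 + K ≤ 2 ^ ⌈Real.logb 2 (Real.exp 1 + K)⌉₊ := by
      rw [← Real.rpow_natCast, ← Real.logb_le_iff_le_rpow one_lt_two (by positivity)]
      exact Nat.le_ceil _
    have h' := ENNReal.ofReal_le_ofReal h
    rw [ENNReal.ofReal_pow two_pos.le, ENNReal.ofReal_ofNat] at h'
    rw [pow_add, pow_add, pow_mul, pow_one, show (2 : ℝ≥0∞) ^ 2 = 4 by norm_num,
      mul_comm (2 : ℝ≥0∞) (4 ^ n)]
    gcongr
  have hAp : ∀ R : Set (Fin n → ℝ), IsCube R →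
      cubeAvg w R * cubeAvg (fun y => w y ^ (-(1 / (p - 1)))) R ^ (p - 1) ≤
        ENNReal.ofReal (Real.exp 1 + K) := by
    intro R hR
    have h1 : cubeAvg (fun y => w y ^ (-(1 / (p - 1)))) R =
        cubeAvg (fun y => ENNReal.ofReal (v y) ^ (-(1 / (p - 1)))) R := by
      refine cubeAvg_congr_ae ?_ R
      filter_upwards [hvw] with x hx
      rw [hx]
    rw [h1, ← cubeAvg_congr_ae hvw]
    have h2 : cubeAvg (fun y => ENNReal.ofReal (v y)) R *
        cubeAvg (fun y => ENNReal.ofReal (v y) ^ (-(1 / (p - 1)))) R ^ (p - 1) ≤ apConst p v :=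
      le_iSup₂_of_le R hR le_rfl
    refine h2.trans ((ENNReal.ofReal_toReal hvp).symm.trans_le (ENNReal.ofReal_le_ofReal ?_))
    linarith [Real.exp_pos 1]
  refine (withDensity_setOf_cube_le (L := N + 1) (A := aInfConst v) hw hw0 hwt (by positivity)
    (fun R hR => ?_) (fun R hR => ?_) (fun k m R hR h₁ h₂ =>
      volume_inter_level_le hp hR hw (hAp R hR) hl h₁ h₂)).trans ?_
  · rw [← wMeas_eq_withDensity hvw]
    exact ⟨wMeas_ne_zero hv hR, wMeas_ne_top hv hR⟩
  · rw [← wMeas_eq_withDensity hvw]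
    refine le_trans (le_of_eq ?_) (lintegral_hlM_le_aInfConst_mul hv hR)
    rw [hlM_congr_ae]
    filter_upwards [hvw] with x hx
    simp only [Set.indicator, ← hx]
  · gcongr
    exact tsum_levelFraction_le n hp hK0

/-- **Quantitative weak-type bound with `u = 1`.** For `v ∈ A_p`, `p > 1`,
`‖M(fv)/v‖_{L^{1,∞}(v)} ≤ c_n [v]_{A_∞} max{p, log(e + [v]_{A_p})} ‖f‖_{L¹(v)}`. -/
theorem quantitative_bound_v_only (n : ℕ) :
    ∃ c : ℝ≥0, 0 < c ∧
      ∀ p : ℝ, 1 < p → ∀ v : (Fin n → ℝ) → ℝ, IsWeight v → apConst p v ≠ ∞ →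
        ∀ f : (Fin n → ℝ) → ℝ, Measurable f → l1Norm f v ≠ ∞ →
          wkNorm (fun x => hlMR (fun y => f y * v y) x / ENNReal.ofReal (v x)) v ≤
            (c : ℝ≥0∞) * aInfConst v *
              ENNReal.ofReal (max p (Real.log (Real.exp 1 + (apConst p v).toReal))) *
              l1Norm f v := by
  refine ⟨16 * 36 ^ n * (2 * n + 8 : ℕ), by positivity, ?_⟩
  intro p hp v hv hvp f _ _
  have hvm : AEMeasurable v := hv.1.aestronglyMeasurable.aemeasurable
  let w : (Fin n → ℝ) → ℝ≥0∞ := fun x => ENNReal.ofReal (hvm.mk v x)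
  have hvw : (fun x => ENNReal.ofReal (v x)) =ᵐ[volume] w := by
    filter_upwards [hvm.ae_eq_mk] with x hx
    simp only [w, ← hx]
  refine iSup₂_le fun t ht => ?_
  have ht0 : (t : ℝ≥0∞) ≠ 0 := ENNReal.coe_ne_zero.2 ht.ne'
  have hti : (t : ℝ≥0∞)⁻¹ ≠ ∞ := ENNReal.inv_ne_top.2 ht0
  let γ := volume.withDensity fun y => (t : ℝ≥0∞)⁻¹ * ENNReal.ofReal |f y * v y|
  have hγ : γ Set.univ = (t : ℝ≥0∞)⁻¹ * l1Norm f v := by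
    rw [withDensity_apply', Measure.restrict_univ, lintegral_const_mul' _ _ hti, l1Norm]
    congr 1
    refine lintegral_congr_ae ?_
    filter_upwards [hv.2] with x hx
    rw [abs_mul, ENNReal.ofReal_mul (abs_nonneg _), abs_of_pos hx]
  have hmain := withDensity_setOf_exists_cube_le hp hv hvp
    (hvm.measurable_mk.ennreal_ofReal : Measurable w) (fun x => ENNReal.ofReal_ne_top) hvw γ
  have hle : wMeas v {x | (t : ℝ≥0∞) < hlMR (fun y => f y * v y) x / ENNReal.ofReal (v x)} ≤
      volume.withDensity w {x | ∃ Q, IsCube Q ∧ x ∈ Q ∧ w x * volume Q < γ Q} := by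
    rw [wMeas_eq_withDensity hvw]
    refine measure_mono_ae (withDensity_absolutelyContinuous volume w ?_)
    filter_upwards [hvw, hv.2] with x hx hpos hlt
    have hlt' : (t : ℝ≥0∞) < hlMR (fun y => f y * v y) x / ENNReal.ofReal (v x) := hlt
    have hw0 : w x ≠ 0 := by rw [← hx]; exact (ENNReal.ofReal_pos.2 hpos).ne'
    rw [hx, ENNReal.lt_div_iff_mul_lt (Or.inl hw0) (Or.inl ENNReal.ofReal_ne_top), hlMR, hlM] at hlt'
    simp only [lt_iSup_iff] at hlt'
    obtain ⟨Q, hQ, hxQ, hlt'⟩ := hlt'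
    refine ⟨Q, hQ, hxQ, ?_⟩
    rw [cubeAvg, ENNReal.lt_div_iff_mul_lt (Or.inl hQ.volume_ne_zero)
      (Or.inl hQ.volume_ne_top)] at hlt'
    have hγQ : γ Q = (∫⁻ y in Q, ENNReal.ofReal |f y * v y|) / t := by
      rw [withDensity_apply', lintegral_const_mul' _ _ hti, ENNReal.div_eq_inv_mul]
    rw [hγQ, ENNReal.lt_div_iff_mul_lt (Or.inl ht0) (Or.inl ENNReal.coe_ne_top)]
    calc w x * volume Q * t = t * w x * volume Q := by ring
      _ < _ := hlt'
  refine (mul_le_mul_right (hle.trans hmain) (t : ℝ≥0∞)).trans (le_of_eq ?_)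
  rw [hγ]
  push_cast
  calc _ = (t * (t : ℝ≥0∞)⁻¹) * (16 * 36 ^ n * (2 * n + 8) * aInfConst v *
        ENNReal.ofReal (max p (Real.log (Real.exp 1 + (apConst p v).toReal))) * l1Norm f v) := by
        ring
    _ = _ := by rw [ENNReal.mul_inv_cancel ht0 ENNReal.coe_ne_top, one_mul]
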